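/- Let V be a Whittaker module of type c. Then the following statements are equivalent: (1) V is irreducible (simple) as a U-module; (2) V admits a central character, i.e. every element of Z(U) acts on V by a scalar; (3) Z_V is a maximal ideal of Z(U); (4) the space of Whittaker vectors of V, {v ∈ V : Ev = cv}, is one-dimensional; (5) every nonzero Whittaker vector of V is cyclic, i.e. generates V as a U-module; (6) every U-module endomorphism of V is a scalar multiple of the identity; (7) V is isomorphic to U/(U·ker ξ + U(E − c)) for some ℂ-algebra homomorphism ξ : Z(U) → ℂ. -/

import Mathlib

set_option synthInstance.maxHeartbeats 1000000
set_option maxHeartbeats 1000000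

noncomputable section

open FreeAlgebra

/-- Generators of the quantum group `U_q(f(K,H))`. -/
inductive Gen : Type
  | E | F | K | Kinv | H | Hinv

/-- The free algebra on the generators. -/
abbrev FA : Type := FreeAlgebra ℂ Gen

def gE : FA := ι ℂ Gen.E
def gF : FA := ι ℂ Gen.F
def gK : FA := ι ℂ Gen.K
def gKi : FA := ι ℂ Gen.Kinv
def gH : FA := ι ℂ Gen.H
def gHi : FA := ι ℂ Gen.Hinv

/-- The defining relations of `U_q(f(K,H))`, where `r` is the element of the free
algebra representing the Laurent polynomial `f(K,H)` appearing in `EF - FE = f(K,H)`. -/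
inductive URel (q : ℂ) (r : FA) : FA → FA → Prop
  | KKi : URel q r (gK * gKi) 1
  | KiK : URel q r (gKi * gK) 1
  | HHi : URel q r (gH * gHi) 1
  | HiH : URel q r (gHi * gH) 1
  | KH  : URel q r (gK * gH) (gH * gK)
  | KE  : URel q r (gK * gE) (q ^ 2 • (gE * gK))
  | KF  : URel q r (gK * gF) ((q ^ 2)⁻¹ • (gF * gK))
  | HE  : URel q r (gH * gE) ((q ^ 2)⁻¹ • (gE * gH))
  | HF  : URel q r (gH * gF) (q ^ 2 • (gF * gH))
  | EF  : URel q r (gE * gF - gF * gE) r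

/-- `U_q(f(K,H))` as a quotient of the free algebra. -/
abbrev Uq (q : ℂ) (r : FA) : Type := RingQuot (URel q r)

variable (q : ℂ) (r : FA)

def uE : Uq q r := RingQuot.mkAlgHom ℂ (URel q r) gE
def uF : Uq q r := RingQuot.mkAlgHom ℂ (URel q r) gF
def uK : Uq q r := RingQuot.mkAlgHom ℂ (URel q r) gK
def uKi : Uq q r := RingQuot.mkAlgHom ℂ (URel q r) gKi
def uH : Uq q r := RingQuot.mkAlgHom ℂ (URel q r) gH
def uHi : Uq q r := RingQuot.mkAlgHom ℂ (URel q r) gHi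

/-- The element `f_m(K,H) = (K^m - H^m)/(q - q⁻¹)` of the free algebra. -/
def fm (q : ℂ) (m : ℕ) : FA := (q - q⁻¹)⁻¹ • (gK ^ m - gH ^ m)

/-- The quantum group `U_q(f_m(K,H))`. -/
abbrev Um (q : ℂ) (m : ℕ) : Type := Uq q (fm q m)

end
/-- The left ideal `U(E - c)` of `U` generated by `E - c`. -/
noncomputable def Lc (q : ℂ) (m : ℕ) (c : ℂ) : Submodule (Um q m) (Um q m) :=
  Submodule.span (Um q m) {uE q (fm q m) - algebraMap ℂ (Um q m) c}

/-- A Whittaker vector of type `c`: a nonzero vector `v` with `E • v = c • v`. -/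
def IsWhittakerVector (q : ℂ) (m : ℕ) (c : ℂ) {V : Type*} [AddCommGroup V]
    [Module (Um q m) V] (v : V) : Prop :=
  v ≠ 0 ∧ uE q (fm q m) • v = algebraMap ℂ (Um q m) c • v

/-- A Whittaker module of type `c`: a `U`-module generated by a Whittaker vector. -/
def IsWhittakerModule (q : ℂ) (m : ℕ) (c : ℂ) (V : Type*) [AddCommGroup V]
    [Module (Um q m) V] : Prop :=
  ∃ v : V, IsWhittakerVector q m c v ∧ ∀ x : V, ∃ u : Um q m, u • v = x

/-- The set `Z_V = Ann_U(V) ∩ Z(U)`. -/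
def ZVset (q : ℂ) (m : ℕ) (V : Type*) [AddCommGroup V] [Module (Um q m) V] :
    Set (Um q m) :=
  {z | z ∈ Subalgebra.center ℂ (Um q m) ∧ ∀ v : V, z • v = 0}
/-- `Z_V = Ann_U(V) ∩ Z(U)` as an ideal of the center `Z(U)`. -/
noncomputable def ZVideal (q : ℂ) (m : ℕ) (V : Type*) [AddCommGroup V]
    [Module (Um q m) V] : Ideal (Subalgebra.center ℂ (Um q m)) where
  carrier := {z | ∀ v : V, (z : Um q m) • v = 0}
  add_mem' := by
    intro a b ha hb v
    have h : ((a + b : Subalgebra.center ℂ (Um q m)) : Um q m)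
        = (a : Um q m) + (b : Um q m) := rfl
    rw [h, add_smul, ha v, hb v, add_zero]
  zero_mem' := by
    intro v
    have h : ((0 : Subalgebra.center ℂ (Um q m)) : Um q m) = 0 := rfl
    rw [h, zero_smul]
  smul_mem' := by
    intro c x hx v
    have h : ((c • x : Subalgebra.center ℂ (Um q m)) : Um q m)
        = (c : Um q m) * (x : Um q m) := rfl
    rw [h, mul_smul, hx v, smul_zero]

section Relations

variable (q : ℂ) (r : FA)

theorem uK_mul_uKi : uK q r * uKi q r = 1 := by
  simpa [uK, uKi] using RingQuot.mkAlgHom_rel ℂ (URel.KKi (q := q) (r := r))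

theorem uKi_mul_uK : uKi q r * uK q r = 1 := by
  simpa [uK, uKi] using RingQuot.mkAlgHom_rel ℂ (URel.KiK (q := q) (r := r))

theorem uH_mul_uHi : uH q r * uHi q r = 1 := by
  simpa [uH, uHi] using RingQuot.mkAlgHom_rel ℂ (URel.HHi (q := q) (r := r))

theorem uHi_mul_uH : uHi q r * uH q r = 1 := by
  simpa [uH, uHi] using RingQuot.mkAlgHom_rel ℂ (URel.HiH (q := q) (r := r))

theorem uK_mul_uH : uK q r * uH q r = uH q r * uK q r := by
  simpa [uH, uK] using RingQuot.mkAlgHom_rel ℂ (URel.KH (q := q) (r := r))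

theorem uK_mul_uE : uK q r * uE q r = q ^ 2 • (uE q r * uK q r) := by
  simpa [uE, uK] using RingQuot.mkAlgHom_rel ℂ (URel.KE (q := q) (r := r))

theorem uK_mul_uF : uK q r * uF q r = (q ^ 2)⁻¹ • (uF q r * uK q r) := by
  simpa [uF, uK] using RingQuot.mkAlgHom_rel ℂ (URel.KF (q := q) (r := r))

theorem uH_mul_uE : uH q r * uE q r = (q ^ 2)⁻¹ • (uE q r * uH q r) := by
  simpa [uE, uH] using RingQuot.mkAlgHom_rel ℂ (URel.HE (q := q) (r := r))

theorem uH_mul_uF : uH q r * uF q r = q ^ 2 • (uF q r * uH q r) := by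
  simpa [uF, uH] using RingQuot.mkAlgHom_rel ℂ (URel.HF (q := q) (r := r))

theorem uE_mul_uF_sub (m : ℕ) :
    uE q (fm q m) * uF q (fm q m) - uF q (fm q m) * uE q (fm q m) =
      (q - q⁻¹)⁻¹ • (uK q (fm q m) ^ m - uH q (fm q m) ^ m) := by
  have h := RingQuot.mkAlgHom_rel ℂ (URel.EF (q := q) (r := fm q m))
  have hr (r : FA) : RingQuot.mkAlgHom ℂ (URel q r) (fm q m) =
      (q - q⁻¹)⁻¹ • (uK q r ^ m - uH q r ^ m) := by simp [fm, uK, uH]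
  rw [map_sub, map_mul, map_mul, hr] at h
  exact h

theorem adjoin_generators :
    Algebra.adjoin ℂ ({uE q r, uF q r, uK q r, uKi q r, uH q r, uHi q r} : Set (Uq q r)) = ⊤ := by
  rw [eq_top_iff, ← (AlgHom.range_eq_top _).2 (RingQuot.mkAlgHom_surjective ℂ (URel q r)),
    ← Algebra.map_top, ← FreeAlgebra.adjoin_range_ι, AlgHom.map_adjoin]
  refine Algebra.adjoin_mono ?_
  rintro _ ⟨_, ⟨g, rfl⟩, rfl⟩
  cases g <;> simp [uE, uF, uK, uKi, uH, uHi, gE, gF, gK, gKi, gH, gHi]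

variable {q r}

/-- If `a b = t • b a`, with `b` invertible, then `a` commutes past the inverse of `b` with `t⁻¹`. -/
theorem mul_inv_eq_smul {A : Type*} [Ring A] [Algebra ℂ A] {a b bi : A} {t : ℂ} (ht : t ≠ 0)
    (h₁ : b * bi = 1) (h₂ : bi * b = 1) (h : b * a = t • (a * b)) :
    bi * a = t⁻¹ • (a * bi) := by
  have : bi * (b * a) * bi = t • (bi * a * (b * bi)) := by
    rw [h]; simp [mul_assoc]
  rw [h₁, mul_one, ← mul_assoc, h₂, one_mul] at this
  rw [this, smul_smul, inv_mul_cancel₀ ht, one_smul]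

theorem pow_mul_eq_smul {A : Type*} [Ring A] [Algebra ℂ A] {a b : A} {t : ℂ}
    (h : b * a = t • (a * b)) (n : ℕ) : b ^ n * a = t ^ n • (a * b ^ n) := by
  induction n with
  | zero => simp
  | succ n ih =>
    rw [pow_succ, mul_assoc, h, mul_smul_comm, ← mul_assoc, ih, smul_mul_assoc, smul_smul,
      pow_succ, mul_assoc, mul_comm]

theorem mem_center_of_commute {z : Uq q r} (hE : Commute z (uE q r)) (hF : Commute z (uF q r))
    (hK : Commute z (uK q r)) (hH : Commute z (uH q r)) :
    z ∈ Subalgebra.center ℂ (Uq q r) := by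
  have inv {b bi : Uq q r} (h₁ : b * bi = 1) (h₂ : bi * b = 1) (h : Commute z b) :
      Commute z bi :=
    h.units_inv_right (u := ⟨b, bi, h₁, h₂⟩)
  rw [Subalgebra.mem_center_iff]
  intro u
  have hu : u ∈ Algebra.adjoin ℂ
      ({uE q r, uF q r, uK q r, uKi q r, uH q r, uHi q r} : Set (Uq q r)) := by
    rw [adjoin_generators]; trivial
  have hle : Algebra.adjoin ℂ
      ({uE q r, uF q r, uK q r, uKi q r, uH q r, uHi q r} : Set (Uq q r)) ≤
      Subalgebra.centralizer ℂ {z} := by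
    refine Algebra.adjoin_le ?_
    rintro x (rfl | rfl | rfl | rfl | rfl | rfl) <;>
      simp only [SetLike.mem_coe, Subalgebra.mem_centralizer_iff, Set.mem_singleton_iff,
        forall_eq]
    exacts [hE, hF, hK, inv (uK_mul_uKi q r) (uKi_mul_uK q r) hK, hH,
      inv (uH_mul_uHi q r) (uHi_mul_uH q r) hH]
  exact ((Subalgebra.mem_centralizer_iff ℂ).1 (hle hu) z rfl).symm

theorem uK_mul_uH_mem_center (hq0 : q ≠ 0) :
    uK q r * uH q r ∈ Subalgebra.center ℂ (Uq q r) := by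
  have hq2 : q ^ 2 ≠ 0 := pow_ne_zero 2 hq0
  refine mem_center_of_commute ?_ ?_ ?_ ?_ <;> rw [commute_iff_eq]
  · rw [mul_assoc, uH_mul_uE, mul_smul_comm, ← mul_assoc, uK_mul_uE, smul_mul_assoc, smul_smul,
      inv_mul_cancel₀ hq2, one_smul, mul_assoc]
  · rw [mul_assoc, uH_mul_uF, mul_smul_comm, ← mul_assoc, uK_mul_uF, smul_mul_assoc, smul_smul,
      mul_inv_cancel₀ hq2, one_smul, mul_assoc]
  · rw [mul_assoc, ← uK_mul_uH]
  · rw [uK_mul_uH, mul_assoc, uK_mul_uH]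

theorem uHi_mul_uKi_mem_center (hq0 : q ≠ 0) :
    uHi q r * uKi q r ∈ Subalgebra.center ℂ (Uq q r) := by
  have h := Subalgebra.mem_center_iff.1 (uK_mul_uH_mem_center (r := r) hq0)
  rw [Subalgebra.mem_center_iff]
  have h₁ : uHi q r * uKi q r * (uK q r * uH q r) = 1 := by
    rw [mul_assoc, ← mul_assoc (uKi q r), uKi_mul_uK, one_mul, uHi_mul_uH]
  have h₂ : uK q r * uH q r * (uHi q r * uKi q r) = 1 := by
    rw [mul_assoc, ← mul_assoc (uH q r), uH_mul_uHi, one_mul, uK_mul_uKi]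
  exact fun b ↦ (show Commute b (uK q r * uH q r) from h b).units_inv_right
    (u := ⟨_, _, h₂, h₁⟩)

end Relations

/-- The Casimir element of `U_q(f_m(K,H))`. -/
noncomputable def casimir (q : ℂ) (m : ℕ) : Um q m :=
  uF q (fm q m) * uE q (fm q m) +
    (((q - q⁻¹)⁻¹ * (1 - (q ^ 2)⁻¹ ^ m)⁻¹) • uK q (fm q m) ^ m +
      ((q - q⁻¹)⁻¹ * ((q ^ 2) ^ m - 1)⁻¹) • uH q (fm q m) ^ m)

theorem casimir_mem_center {q : ℂ} (hq0 : q ≠ 0) (hq : ∀ n : ℕ, 0 < n → q ^ n ≠ 1)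
    {m : ℕ} (hm : 1 ≤ m) : casimir q m ∈ Subalgebra.center ℂ (Um q m) := by
  have hq2 : q ^ 2 ≠ 0 := pow_ne_zero 2 hq0
  have hqm : (q ^ 2) ^ m ≠ 1 := by
    rw [← pow_mul]; exact hq _ (by lia)
  have hb : (q ^ 2) ^ m - 1 ≠ 0 := sub_ne_zero.2 hqm
  have ha : 1 - (q ^ 2)⁻¹ ^ m ≠ 0 := by
    rw [inv_pow, sub_ne_zero, ne_comm, Ne, inv_eq_one]; exact hqm
  have hEF := sub_eq_iff_eq_add.1 (uE_mul_uF_sub q m)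
  have hKE := pow_mul_eq_smul (uK_mul_uE q (fm q m)) m
  have hKF := pow_mul_eq_smul (uK_mul_uF q (fm q m)) m
  have hHE := pow_mul_eq_smul (uH_mul_uE q (fm q m)) m
  have hHF := pow_mul_eq_smul (uH_mul_uF q (fm q m)) m
  have hKE1 := uK_mul_uE q (fm q m)
  have hKF1 := uK_mul_uF q (fm q m)
  have hHE1 := uH_mul_uE q (fm q m)
  have hKH : Commute (uK q (fm q m)) (uH q (fm q m)) := uK_mul_uH q (fm q m)
  have hfe {x : Um q m} {t : ℂ} (ht : t ≠ 0)
      (h₁ : x * uE q (fm q m) = t • (uE q (fm q m) * x))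
      (h₂ : x * uF q (fm q m) = t⁻¹ • (uF q (fm q m) * x)) :
      Commute (uF q (fm q m) * uE q (fm q m)) x := by
    rw [commute_iff_eq, ← mul_assoc x, h₂, smul_mul_assoc, mul_assoc _ x, h₁, mul_smul_comm, smul_smul,
      inv_mul_cancel₀ ht, one_smul, mul_assoc]
  unfold casimir
  refine mem_center_of_commute ?_ ?_ ?_ ?_
  · generalize uE q (fm q m) = e at *
    generalize uF q (fm q m) = f at *
    generalize uK q (fm q m) ^ m = k at *
    generalize uH q (fm q m) ^ m = h at *
    have hs : (q ^ 2) ^ m ≠ 0 := pow_ne_zero m hq2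
    rw [inv_pow] at *
    generalize (q ^ 2) ^ m = s at *
    generalize (q - q⁻¹)⁻¹ = t at *
    rw [commute_iff_eq]
    simp only [add_mul, mul_add, smul_mul_assoc, mul_smul_comm, ← mul_assoc e f e, hEF, hKE, hHE,
      sub_mul, smul_sub]
    match_scalars
    all_goals (field_simp <;> ring)
  · generalize uE q (fm q m) = e at *
    generalize uF q (fm q m) = f at *
    generalize uK q (fm q m) ^ m = k at *
    generalize uH q (fm q m) ^ m = h at *
    have hs : (q ^ 2) ^ m ≠ 0 := pow_ne_zero m hq2
    rw [inv_pow] at *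
    generalize (q ^ 2) ^ m = s at *
    generalize (q - q⁻¹)⁻¹ = t at *
    rw [commute_iff_eq]
    simp only [add_mul, mul_add, smul_mul_assoc, mul_smul_comm, mul_assoc f e f, hEF, hKF, hHF,
      mul_sub, smul_sub]
    match_scalars
    all_goals (field_simp <;> ring)
  · exact (hfe hq2 hKE1 hKF1).add_left
      ((((Commute.refl _).pow_left m).smul_left _).add_left ((hKH.symm.pow_left m).smul_left _))
  · exact (hfe (inv_ne_zero hq2) hHE1 (by rw [inv_inv]; exact uH_mul_uF q (fm q m))).add_left
      (((hKH.pow_left m).smul_left _).add_left (((Commute.refl _).pow_left m).smul_left _))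

section LinearAlgebra

open Polynomial

theorem isUnit_aeval_of_forall_isUnit_sub {A : Type*} [Ring A] [Algebra ℂ A] {T : A} {p : ℂ[X]}
    (hp : p ≠ 0) (h : ∀ a : ℂ, IsUnit (T - algebraMap ℂ A a)) : IsUnit (aeval T p) := by
  rw [(IsAlgClosed.splits p).eq_prod_roots, map_mul, aeval_C]
  refine ((isUnit_iff_ne_zero.2 (leadingCoeff_ne_zero.2 hp)).map _).mul ?_
  generalize p.roots = s
  induction s using Multiset.induction with
  | empty => simp
  | cons a s ih => simpa using (h a).mul ih

/-- An endomorphism of a nonzero complex vector space of countable dimension has nonempty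
spectrum. -/
theorem exists_not_isUnit_sub_algebraMap {W : Type*} [AddCommGroup W] [Module ℂ W] [Nontrivial W]
    (hW : Module.rank ℂ W ≤ Cardinal.aleph0) (T : Module.End ℂ W) :
    ∃ a : ℂ, ¬ IsUnit (T - algebraMap ℂ (Module.End ℂ W) a) := by
  by_contra! H
  obtain ⟨w, hw⟩ := exists_ne (0 : W)
  choose R hR using fun a ↦ (H a).exists_right_inv
  have hli : LinearIndependent ℂ fun a : ℂ ↦ R a w := by
    classical
    refine linearIndependent_iff'.2 fun s g hg i hi ↦ ?_
    have hp (a : ℂ) (ha : a ∈ s) : aeval T (∏ b ∈ s.erase a, (X - C b)) w =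
        aeval T (∏ b ∈ s, (X - C b)) (R a w) := by
      rw [← Finset.prod_erase_mul _ _ ha, map_mul, map_sub, aeval_X, aeval_C,
        ← Module.End.mul_apply, mul_assoc, hR, mul_one]
    have hQ : aeval T (∑ a ∈ s, C (g a) * ∏ b ∈ s.erase a, (X - C b)) w = 0 := by
      rw [map_sum (aeval T), LinearMap.sum_apply]
      calc _ = ∑ a ∈ s, aeval T (∏ b ∈ s, (X - C b)) (g a • R a w) := by
            refine Finset.sum_congr rfl fun a ha ↦ ?_
            rw [map_mul, aeval_C, Module.End.mul_apply, hp a ha, map_smul,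
              Module.algebraMap_end_apply]
        _ = 0 := (map_sum _ _ _).symm.trans (by rw [hg, map_zero])
    have hQ0 : ∑ a ∈ s, C (g a) * ∏ b ∈ s.erase a, (X - C b) = 0 := by
      by_contra hne
      have hu := isUnit_aeval_of_forall_isUnit_sub hne H
      exact hw (((Module.End.isUnit_iff _).1 hu).1 (by rw [hQ, map_zero]))
    have he := congrArg (eval i) hQ0
    rw [eval_finsetSum, Finset.sum_eq_single_of_mem i hi] at he
    · rw [eval_mul, eval_C, eval_prod, eval_zero, mul_eq_zero, Finset.prod_eq_zero_iff] at he
      refine he.resolve_right ?_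
      rintro ⟨b, hb, hb'⟩
      rw [eval_sub, eval_X, eval_C, sub_eq_zero] at hb'
      exact Finset.ne_of_mem_erase hb hb'.symm
    · intro a _ hai
      rw [eval_mul, eval_prod, Finset.prod_eq_zero (Finset.mem_erase.2 ⟨hai.symm, hi⟩) (by simp),
        mul_zero]
  have hcard := hli.cardinal_lift_le_rank.trans (Cardinal.lift_le.2 hW)
  rw [Cardinal.mk_complex, Cardinal.lift_continuum, Cardinal.lift_aleph0] at hcard
  exact hcard.not_gt Cardinal.aleph0_lt_continuum

/-- Eigenvectors for distinct eigenvalues summing to zero all vanish. -/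
theorem eq_zero_of_sum_eigenvectors_eq_zero {ι W : Type*} [AddCommGroup W] [Module ℂ W]
    (f : Module.End ℂ W) {μ : ι → ℂ} (hμ : Function.Injective μ) (s : Finset ι) (g : ι → W)
    (hg : ∀ i, f (g i) = μ i • g i) (h : ∑ i ∈ s, g i = 0) : ∀ i ∈ s, g i = 0 := by
  have hind := f.eigenspaces_iSupIndep.comp hμ
  rw [iSupIndep_iff_finsetSum_eq_zero_imp_eq_zero] at hind
  exact hind s g (fun i _ ↦ Module.End.mem_eigenspace_iff.2 (hg i)) h

end LinearAlgebra

/-- The unit of `U_q(f(K,H))` with value `K`. -/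
noncomputable def uKUnit (q : ℂ) (r : FA) : (Uq q r)ˣ :=
  ⟨uK q r, uKi q r, uK_mul_uKi q r, uKi_mul_uK q r⟩

theorem rank_Uq_le_aleph0 (q : ℂ) (r : FA) : Module.rank ℂ (Uq q r) ≤ Cardinal.aleph0 := by
  have h := Algebra.rank_adjoin_le (R := ℂ)
    ({uE q r, uF q r, uK q r, uKi q r, uH q r, uHi q r} : Set (Uq q r))
  rw [adjoin_generators, Subalgebra.topEquiv.toLinearEquiv.rank_eq, max_eq_right] at h
  · exact h
  · exact (Set.toFinite _).countable.le_aleph0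

/-- The action of a central element as a module endomorphism. -/
def centralEnd {A : Type*} [Ring A] [Algebra ℂ A] (V : Type*) [AddCommGroup V] [Module A V]
    (z : Subalgebra.center ℂ A) : V →ₗ[A] V where
  toFun v := (z : A) • v
  map_add' := smul_add _
  map_smul' u v := by
    rw [RingHom.id_apply, smul_smul, smul_smul, Subalgebra.mem_center_iff.1 z.2 u]

/-- The elements of an algebra which preserve a given subspace of a module. -/
def subspaceStabilizer {A V : Type*} [Ring A] [Algebra ℂ A] [AddCommGroup V] [Module A V]
    [Module ℂ V] [IsScalarTower ℂ A V] (N : Submodule ℂ V) : Subalgebra ℂ A where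
  carrier := {x | ∀ v ∈ N, x • v ∈ N}
  mul_mem' hx hy v hv := by rw [mul_smul]; exact hx _ (hy _ hv)
  add_mem' hx hy v hv := by rw [add_smul]; exact N.add_mem (hx _ hv) (hy _ hv)
  algebraMap_mem' a v hv := by rw [algebraMap_smul]; exact N.smul_mem a hv

section Whittaker

variable {q : ℂ} {m : ℕ} {c : ℂ} {V : Type*} [AddCommGroup V] [Module (Um q m) V] [Module ℂ V]
  [IsScalarTower ℂ (Um q m) V]

theorem rank_le_aleph0_of_cyclic {w : V} (hw : ∀ x : V, ∃ u : Um q m, u • w = x) :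
    Module.rank ℂ V ≤ Cardinal.aleph0 := by
  have h := ((LinearMap.toSpanSingleton (Um q m) V w).restrictScalars ℂ).lift_rank_le_of_surjective
    fun x ↦ hw x
  have h' := h.trans (Cardinal.lift_le.2 (rank_Uq_le_aleph0 q (fm q m)))
  rwa [Cardinal.lift_aleph0, Cardinal.lift_le_aleph0] at h'

theorem uE_smul_smul {x : Um q m} {t μ : ℂ} (ht : t ≠ 0)
    (h : x * uE q (fm q m) = t • (uE q (fm q m) * x)) {v : V} (hv : uE q (fm q m) • v = μ • v) :
    uE q (fm q m) • x • v = (t⁻¹ * μ) • x • v := by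
  rw [mul_smul, ← smul_comm x μ v, ← hv, smul_smul x, h, smul_assoc, inv_smul_smul₀ ht, mul_smul]

theorem uKi_mul_uE (hq0 : q ≠ 0) (r : FA) :
    uKi q r * uE q r = (q ^ 2)⁻¹ • (uE q r * uKi q r) :=
  mul_inv_eq_smul (pow_ne_zero 2 hq0) (uK_mul_uKi q r) (uKi_mul_uK q r) (uK_mul_uE q r)

theorem uHi_mul_uE (hq0 : q ≠ 0) (r : FA) :
    uHi q r * uE q r = (q ^ 2)⁻¹⁻¹ • (uE q r * uHi q r) :=
  mul_inv_eq_smul (inv_ne_zero (pow_ne_zero 2 hq0)) (uH_mul_uHi q r) (uHi_mul_uH q r)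
    (uH_mul_uE q r)

theorem uE_smul_zpow_smul (hq0 : q ≠ 0) {μ : ℂ} {v : V} (hv : uE q (fm q m) • v = μ • v) (j : ℤ) :
    uE q (fm q m) • ((uKUnit q (fm q m) ^ j : (Um q m)ˣ) : Um q m) • v =
      (μ * (q ^ 2) ^ (-j)) • ((uKUnit q (fm q m) ^ j : (Um q m)ˣ) : Um q m) • v := by
  have hq2 : q ^ 2 ≠ 0 := pow_ne_zero 2 hq0
  induction j using Int.induction_on with
  | zero => simpa using hv
  | succ i ih =>
    have h := uE_smul_smul hq2 (uK_mul_uE q (fm q m)) ih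
    rw [add_comm, zpow_one_add, Units.val_mul, mul_smul]
    convert! h using 2
    rw [neg_add, zpow_add₀ hq2, zpow_neg_one]; ring
  | pred i ih =>
    have h := uE_smul_smul (inv_ne_zero hq2) (uKi_mul_uE hq0 (fm q m)) ih
    rw [sub_eq_neg_add, zpow_add, zpow_neg_one, Units.val_mul, mul_smul]
    convert! h using 2
    rw [neg_add, zpow_add₀ hq2, neg_neg 1, zpow_one, inv_inv]; ring

/-- A set of eigenvectors of `E` for nonzero eigenvalues, whose span contains a generator and is
stable under `K`, `H`, their inverses and the Casimir element, spans the module. -/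
theorem span_eq_top_of_eigenvectors {T : Set V} {w : V} (hw : ∀ x : V, ∃ u : Um q m, u • w = x)
    (hwT : w ∈ Submodule.span ℂ T)
    (hE : ∀ v ∈ T, ∃ μ : ℂ, μ ≠ 0 ∧ uE q (fm q m) • v = μ • v)
    (hK : ∀ v ∈ T, uK q (fm q m) • v ∈ Submodule.span ℂ T)
    (hKi : ∀ v ∈ T, uKi q (fm q m) • v ∈ Submodule.span ℂ T)
    (hH : ∀ v ∈ T, uH q (fm q m) • v ∈ Submodule.span ℂ T)
    (hHi : ∀ v ∈ T, uHi q (fm q m) • v ∈ Submodule.span ℂ T)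
    (hC : ∀ v ∈ T, casimir q m • v ∈ Submodule.span ℂ T) :
    Submodule.span ℂ T = ⊤ := by
  have key (x : Um q m) (hx : ∀ v ∈ T, x • v ∈ Submodule.span ℂ T) :
      x ∈ subspaceStabilizer (A := Um q m) (Submodule.span ℂ T) :=
    Submodule.span_le (p := (Submodule.span ℂ T).comap (Algebra.lsmul ℂ ℂ V x)).2 hx
  have hF : ∀ v ∈ T, uF q (fm q m) • v ∈ Submodule.span ℂ T := by
    intro v hv
    obtain ⟨μ, hμ, hEv⟩ := hE v hv
    have hFE : uF q (fm q m) * uE q (fm q m) ∈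
        subspaceStabilizer (A := Um q m) (Submodule.span ℂ T) := by
      rw [← add_sub_cancel_right (uF q (fm q m) * uE q (fm q m))]
      exact sub_mem (key _ hC) (add_mem (Subalgebra.smul_mem _ (pow_mem (key _ hK) m) _)
        (Subalgebra.smul_mem _ (pow_mem (key _ hH) m) _))
    have h := Submodule.smul_mem _ μ⁻¹ (hFE v (Submodule.subset_span hv))
    rwa [mul_smul, hEv, smul_comm _ μ, inv_smul_smul₀ hμ] at h
  have hE' : ∀ v ∈ T, uE q (fm q m) • v ∈ Submodule.span ℂ T := by
    intro v hv
    obtain ⟨μ, -, hEv⟩ := hE v hv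
    rw [hEv]
    exact Submodule.smul_mem _ _ (Submodule.subset_span hv)
  have htop : subspaceStabilizer (A := Um q m) (Submodule.span ℂ T) = ⊤ := by
    rw [eq_top_iff, ← adjoin_generators]
    refine Algebra.adjoin_le ?_
    rintro x (rfl | rfl | rfl | rfl | rfl | rfl)
    exacts [key _ hE', key _ hF, key _ hK, key _ hKi, key _ hH, key _ hHi]
  rw [eq_top_iff]
  rintro x -
  obtain ⟨u, rfl⟩ := hw x
  exact (htop ▸ Algebra.mem_top : u ∈ subspaceStabilizer (Submodule.span ℂ T)) w hwT

theorem weight_injective (hq0 : q ≠ 0) (hq : ∀ n : ℕ, 0 < n → q ^ n ≠ 1) (hc : c ≠ 0) :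
    Function.Injective fun j : ℤ ↦ c * (q ^ 2) ^ j := by
  intro i j h
  have h' := mul_left_cancel₀ hc h
  by_contra hij
  wlog hlt : i < j generalizing i j
  · exact this h.symm h'.symm (Ne.symm hij) (lt_of_le_of_ne (not_lt.1 hlt) (Ne.symm hij))
  obtain ⟨n, hn⟩ := Int.eq_ofNat_of_zero_le (sub_nonneg.2 hlt.le)
  refine hq (2 * n) (by lia) ?_
  rw [pow_mul, ← zpow_natCast, ← hn, zpow_sub₀ (pow_ne_zero 2 hq0), ← h', div_self]
  exact zpow_ne_zero _ (pow_ne_zero 2 hq0)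

/-- Every nonzero submodule of a Whittaker module contains a Whittaker vector. -/
theorem exists_whittaker_mem (hq0 : q ≠ 0) (hq : ∀ n : ℕ, 0 < n → q ^ n ≠ 1) (hm : 1 ≤ m)
    (hc : c ≠ 0) {w : V} (hEw : uE q (fm q m) • w = c • w)
    (hw : ∀ x : V, ∃ u : Um q m, u • w = x) {N : Submodule (Um q m) V} (hN : N ≠ ⊥) :
    ∃ v ∈ N, v ≠ 0 ∧ uE q (fm q m) • v = c • v := by
  have hq2 : q ^ 2 ≠ 0 := pow_ne_zero 2 hq0
  set T : Set V := {v | ∃ j : ℤ, uE q (fm q m) • v = (c * (q ^ 2) ^ j) • v}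
  have shift_up {x : Um q m} (hx : x * uE q (fm q m) = (q ^ 2)⁻¹ • (uE q (fm q m) * x)) :
      ∀ v ∈ T, x • v ∈ Submodule.span ℂ T := by
    rintro v ⟨j, hj⟩
    refine Submodule.subset_span ⟨j + 1, ?_⟩
    rw [uE_smul_smul (inv_ne_zero hq2) hx hj, inv_inv, zpow_add_one₀ hq2]
    congr 1; ring
  have shift_down {x : Um q m} (hx : x * uE q (fm q m) = q ^ 2 • (uE q (fm q m) * x)) :
      ∀ v ∈ T, x • v ∈ Submodule.span ℂ T := by
    rintro v ⟨j, hj⟩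
    refine Submodule.subset_span ⟨j - 1, ?_⟩
    rw [uE_smul_smul hq2 hx hj, zpow_sub_one₀ hq2]
    congr 1; ring
  have hspan : Submodule.span ℂ T = ⊤ := by
    refine span_eq_top_of_eigenvectors hw (Submodule.subset_span ⟨0, by simpa using hEw⟩) ?_
      (shift_down (uK_mul_uE _ _)) (shift_up (uKi_mul_uE hq0 _)) (shift_up (uH_mul_uE _ _))
      (shift_down (by simpa using uHi_mul_uE hq0 (fm q m))) ?_
    · rintro v ⟨j, hj⟩
      exact ⟨_, mul_ne_zero hc (zpow_ne_zero j hq2), hj⟩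
    · rintro v ⟨j, hj⟩
      refine Submodule.subset_span ⟨j, ?_⟩
      rw [smul_smul, Subalgebra.mem_center_iff.1 (casimir_mem_center hq0 hq hm), mul_smul, hj,
        smul_comm]
  obtain ⟨x, hxN, hx0⟩ := N.exists_mem_ne_zero_of_ne_bot hN
  have hx : x ∈ ⨆ j : ℤ, Module.End.eigenspace (Algebra.lsmul ℂ ℂ V (uE q (fm q m)))
      (c * (q ^ 2) ^ j) := by
    have hle : Submodule.span ℂ T ≤ ⨆ j : ℤ,
        Module.End.eigenspace (Algebra.lsmul ℂ ℂ V (uE q (fm q m))) (c * (q ^ 2) ^ j) := by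
      rw [Submodule.span_le]
      rintro v ⟨j, hj⟩
      exact Submodule.mem_iSup_of_mem j (Module.End.mem_eigenspace_iff.2 hj)
    exact hle (hspan ▸ Submodule.mem_top)
  obtain ⟨g, hg, hgx⟩ := (Submodule.mem_iSup_iff_exists_finsupp _ _).1 hx
  have hgE (j : ℤ) : uE q (fm q m) • g j = (c * (q ^ 2) ^ j) • g j :=
    Module.End.mem_eigenspace_iff.1 (hg j)
  have hgN : ∀ j ∈ g.support, N.mkQ (g j) = 0 := by
    refine eq_zero_of_sum_eigenvectors_eq_zero
      (Algebra.lsmul ℂ ℂ (V ⧸ N) (uE q (fm q m))) (weight_injective hq0 hq hc) g.support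
      (fun j ↦ N.mkQ (g j)) (fun j ↦ ?_) ?_
    · change uE q (fm q m) • N.mkQ (g j) = _
      rw [← map_smul, hgE]
      rfl
    · rw [← map_sum, show ∑ j ∈ g.support, g j = x from hgx]
      exact (Submodule.Quotient.mk_eq_zero N).2 hxN
  have hne : g.support.Nonempty := by
    rw [Finset.nonempty_iff_ne_empty]
    intro h
    rw [Finsupp.sum, h, Finset.sum_empty] at hgx
    exact hx0 hgx.symm
  obtain ⟨j, hj⟩ := hne
  refine ⟨((uKUnit q (fm q m) ^ j : (Um q m)ˣ) : Um q m) • g j,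
    N.smul_mem _ ((Submodule.Quotient.mk_eq_zero N).1 (hgN j hj)), ?_, ?_⟩
  · rw [← Units.smul_def, Ne, smul_eq_zero_iff_eq]
    exact Finsupp.mem_support_iff.1 hj
  · rw [uE_smul_zpow_smul hq0 (hgE j), mul_assoc, zpow_neg,
      mul_inv_cancel₀ (zpow_ne_zero j hq2), mul_one]

/-- In a Whittaker module with a central character the Whittaker vectors form a line. -/
theorem whittaker_eq_smul (hq0 : q ≠ 0) (hq : ∀ n : ℕ, 0 < n → q ^ n ≠ 1) (hm : 1 ≤ m)
    (hc : c ≠ 0) {w : V} (hEw : uE q (fm q m) • w = c • w)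
    (hw : ∀ x : V, ∃ u : Um q m, u • w = x)
    (hz : ∀ z ∈ Subalgebra.center ℂ (Um q m), ∃ a : ℂ, ∀ v : V, z • v = a • v)
    {x : V} (hx : uE q (fm q m) • x = c • x) : ∃ a : ℂ, x = a • w := by
  have hq2 : q ^ 2 ≠ 0 := pow_ne_zero 2 hq0
  set k : ℤ → V := fun j ↦ ((uKUnit q (fm q m) ^ j : (Um q m)ˣ) : Um q m) • w with hk
  have hkE (j : ℤ) : uE q (fm q m) • k j = (c * (q ^ 2) ^ (-j)) • k j :=
    uE_smul_zpow_smul hq0 hEw j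
  have hkK (j : ℤ) : uK q (fm q m) • k j = k (1 + j) := by
    simp only [hk, zpow_one_add, Units.val_mul, mul_smul]; rfl
  have hkKi (j : ℤ) : uKi q (fm q m) • k j = k (-1 + j) := by
    simp only [hk, zpow_add, zpow_neg_one, Units.val_mul, mul_smul]; rfl
  have hmem (j : ℤ) : k j ∈ Submodule.span ℂ (Set.range k) :=
    Submodule.subset_span ⟨j, rfl⟩
  have hspan : Submodule.span ℂ (Set.range k) = ⊤ := by
    refine span_eq_top_of_eigenvectors hw (by simpa [hk] using hmem 0) ?_ ?_ ?_ ?_ ?_ ?_ <;>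
      rintro _ ⟨j, rfl⟩
    · exact ⟨_, mul_ne_zero hc (zpow_ne_zero _ hq2), hkE j⟩
    · exact hkK j ▸ hmem _
    · exact hkKi j ▸ hmem _
    · obtain ⟨a, ha⟩ := hz _ (uK_mul_uH_mem_center hq0)
      have h : uH q (fm q m) • k j = a • k (-1 + j) := by
        rw [← hkKi, ← smul_comm (uKi q (fm q m)) a, ← ha, smul_smul (uKi q (fm q m)), ← mul_assoc, uKi_mul_uK, one_mul]
      exact h ▸ Submodule.smul_mem _ _ (hmem _)
    · obtain ⟨a, ha⟩ := hz _ (uHi_mul_uKi_mem_center hq0)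
      have h : uHi q (fm q m) • k j = a • k (1 + j) := by
        rw [← hkK, ← ha, smul_smul (_ * _) (uK q (fm q m)), mul_assoc, uKi_mul_uK, mul_one]
      exact h ▸ Submodule.smul_mem _ _ (hmem _)
    · obtain ⟨a, ha⟩ := hz _ (casimir_mem_center hq0 hq hm)
      exact ha (k j) ▸ Submodule.smul_mem _ _ (hmem _)
  obtain ⟨l, hl⟩ := Finsupp.mem_span_range_iff_exists_finsupp.1
    (hspan ▸ Submodule.mem_top : x ∈ Submodule.span ℂ (Set.range k))
  have h0 := eq_zero_of_sum_eigenvectors_eq_zero (Algebra.lsmul ℂ ℂ V (uE q (fm q m)))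
    ((weight_injective hq0 hq hc).comp neg_injective) (insert 0 l.support)
    (fun j ↦ l j • k j - if j = 0 then x else 0) ?_ ?_ 0 (Finset.mem_insert_self _ _)
  · refine ⟨l 0, ?_⟩
    rw [if_pos rfl, sub_eq_zero] at h0
    simpa [hk] using h0.symm
  · intro j
    change uE q (fm q m) • (l j • k j - if j = 0 then x else 0) = _
    rw [smul_sub, smul_sub, smul_comm _ (l j), hkE, smul_comm (l j)]
    split_ifs with hj
    · subst hj; simp [hx]
    · simp
  · rw [Finset.sum_sub_distrib, Finset.sum_ite_eq', if_pos (Finset.mem_insert_self _ _),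
      ← Finsupp.sum_of_support_subset l (Finset.subset_insert _ _) (fun j a ↦ a • k j) (by simp),
      hl, sub_self]

theorem isSimpleModule_of_central_character (hq0 : q ≠ 0) (hq : ∀ n : ℕ, 0 < n → q ^ n ≠ 1)
    (hm : 1 ≤ m) (hc : c ≠ 0) {w : V} (hw0 : w ≠ 0) (hEw : uE q (fm q m) • w = c • w)
    (hw : ∀ x : V, ∃ u : Um q m, u • w = x)
    (hz : ∀ z ∈ Subalgebra.center ℂ (Um q m), ∃ a : ℂ, ∀ v : V, z • v = a • v) :
    IsSimpleModule (Um q m) V := by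
  have : Nontrivial V := ⟨w, 0, hw0⟩
  refine { eq_bot_or_eq_top := fun N ↦ or_iff_not_imp_left.2 fun hN ↦ ?_ }
  obtain ⟨v, hvN, hv0, hEv⟩ := exists_whittaker_mem hq0 hq hm hc hEw hw hN
  obtain ⟨a, rfl⟩ := whittaker_eq_smul hq0 hq hm hc hEw hw hz hEv
  have hwN : w ∈ N := by
    have ha : a ≠ 0 := fun h ↦ hv0 (by rw [h, zero_smul])
    simpa [inv_smul_smul₀ ha] using N.smul_of_tower_mem a⁻¹ hvN
  rw [eq_top_iff]
  rintro x -
  obtain ⟨u, rfl⟩ := hw x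
  exact N.smul_mem u hwN

end Whittaker

/-- The center acts through `ξ` on the quotient by a left ideal containing `U·ker ξ`. -/
theorem central_smul_mkQ {A : Type*} [Ring A] [Algebra ℂ A] {P : Submodule A A}
    (ξ : Subalgebra.center ℂ A →ₐ[ℂ] ℂ) (z : Subalgebra.center ℂ A) (u : A) :
    (z : A) • (Submodule.span A (Subtype.val '' (RingHom.ker ξ : Set (Subalgebra.center ℂ A))) ⊔
        P).mkQ u =
      algebraMap ℂ A (ξ z) • (Submodule.span A
        (Subtype.val '' (RingHom.ker ξ : Set (Subalgebra.center ℂ A))) ⊔ P).mkQ u := by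
  rw [← map_smul, ← map_smul]
  refine (Submodule.Quotient.eq _).2 (Submodule.mem_sup_left ?_)
  have h : (z : A) • u - algebraMap ℂ A (ξ z) • u =
      u • ((z - algebraMap ℂ _ (ξ z) : Subalgebra.center ℂ A) : A) := by
    rw [smul_eq_mul, smul_eq_mul, smul_eq_mul, ← sub_mul]
    exact (Subalgebra.mem_center_iff.1 (z - algebraMap ℂ _ (ξ z)).2 u).symm
  rw [h]
  refine Submodule.smul_mem _ _ (Submodule.subset_span ⟨_, ?_, rfl⟩)
  simp [RingHom.mem_ker]

/-- For a Whittaker module `V` of type `c` over `U = U_q(f_m(K,H))`,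
the following are equivalent: (1) `V` is simple; (2) `V` admits a central character;
(3) `Z_V` is a maximal ideal of `Z(U)`; (4) the space of Whittaker vectors of `V` is
one-dimensional; (5) every nonzero Whittaker vector of `V` is cyclic; (6) every
`U`-endomorphism of `V` is scalar; (7) `V ≅ U/(U·ker ξ + U(E - c))` for some central
character `ξ : Z(U) → ℂ`. -/
theorem stmt19 (q : ℂ) (hq0 : q ≠ 0) (hq : ∀ n : ℕ, 0 < n → q ^ n ≠ 1)
    (m : ℕ) (hm : 1 ≤ m) (c : ℂ) (hc : c ≠ 0)
    (V : Type*) [AddCommGroup V] [Module (Um q m) V]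
    (hV : IsWhittakerModule q m c V) :
    List.TFAE [
      IsSimpleModule (Um q m) V,
      ∀ z ∈ Subalgebra.center ℂ (Um q m), ∃ a : ℂ, ∀ v : V,
        z • v = algebraMap ℂ (Um q m) a • v,
      (ZVideal q m V).IsMaximal,
      ∃ v₀ : V, IsWhittakerVector q m c v₀ ∧
        ∀ v : V, uE q (fm q m) • v = algebraMap ℂ (Um q m) c • v →
          ∃ a : ℂ, v = algebraMap ℂ (Um q m) a • v₀,
      ∀ v : V, IsWhittakerVector q m c v → ∀ x : V, ∃ u : Um q m, u • v = x,
      ∀ φ : V →ₗ[Um q m] V, ∃ a : ℂ, ∀ v : V, φ v = algebraMap ℂ (Um q m) a • v,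
      ∃ ξ : Subalgebra.center ℂ (Um q m) →ₐ[ℂ] ℂ,
        Nonempty (V ≃ₗ[Um q m] (Um q m ⧸ (Submodule.span (Um q m)
          (Subtype.val '' (RingHom.ker ξ : Set (Subalgebra.center ℂ (Um q m))))
          ⊔ Lc q m c)))
    ] := by
  let _ :  Module ℂ V := Module.compHom V (algebraMap ℂ (Um q m))
  have : IsScalarTower ℂ (Um q m) V := ⟨fun a u v ↦ by
    rw [Algebra.smul_def, mul_smul]; rfl⟩
  have alg (a : ℂ) (v : V) : algebraMap ℂ (Um q m) a • v = a • v := rfl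
  simp only [IsWhittakerVector, alg]
  obtain ⟨w, ⟨hw0, hEw⟩, hw⟩ := hV
  rw [alg] at hEw
  have : Nontrivial V := ⟨w, 0, hw0⟩
  have hrank := rank_le_aleph0_of_cyclic hw
  have sub_smul_eq (z : Subalgebra.center ℂ (Um q m)) (a : ℂ) (v : V) :
      ((z - algebraMap ℂ _ a : Subalgebra.center ℂ (Um q m)) : Um q m) • v =
        (z : Um q m) • v - a • v := sub_smul (z : Um q m) (algebraMap ℂ (Um q m) a) v
  have hspec (z : Subalgebra.center ℂ (Um q m)) : ∃ a : ℂ, ¬ Function.Bijective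
      (centralEnd V (z - algebraMap ℂ _ a)) := by
    obtain ⟨a, ha⟩ := exists_not_isUnit_sub_algebraMap hrank (Algebra.lsmul ℂ ℂ V (z : Um q m))
    refine ⟨a, fun h ↦ ha ((Module.End.isUnit_iff _).2 ?_)⟩
    convert! h using 1
    funext v
    exact (sub_smul_eq z a v).symm
  tfae_have 1 → 2 := by
    intro hs z hz
    obtain ⟨a, ha⟩ := hspec ⟨z, hz⟩
    refine ⟨a, fun v ↦ sub_eq_zero.1 ?_⟩
    rw [← sub_smul_eq ⟨z, hz⟩]
    exact LinearMap.congr_fun ((LinearMap.bijective_or_eq_zero _).resolve_left ha) v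
  tfae_have 2 → 1 := isSimpleModule_of_central_character hq0 hq hm hc hw0 hEw hw
  tfae_have 2 → 3 := by
    intro h
    refine Ideal.isMaximal_iff.2 ⟨fun h1 ↦ hw0 (by simpa using h1 w), fun J x hJ hx hxJ ↦ ?_⟩
    obtain ⟨a, ha⟩ := h x x.2
    have ha0 : a ≠ 0 := by
      rintro rfl
      exact hx fun v ↦ by rw [ha, zero_smul]
    have hmem : -(x - algebraMap ℂ _ a) ∈ J := hJ fun v ↦ by
      rw [NegMemClass.coe_neg, neg_smul, sub_smul_eq, ha, sub_self, neg_zero]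
    have haJ : algebraMap ℂ (Subalgebra.center ℂ (Um q m)) a ∈ J := by
      rw [show algebraMap ℂ (Subalgebra.center ℂ (Um q m)) a = -(x - algebraMap ℂ _ a) + x by abel]
      exact J.add_mem hmem hxJ
    have h1 := J.mul_mem_left (algebraMap ℂ _ a⁻¹) haJ
    rwa [← map_mul, inv_mul_cancel₀ ha0, map_one] at h1
  tfae_have 3 → 2 := by
    intro hmax z hz
    obtain ⟨a, ha⟩ := hspec ⟨z, hz⟩
    by_cases hmem : (⟨z, hz⟩ - algebraMap ℂ _ a : Subalgebra.center ℂ (Um q m)) ∈ ZVideal q m V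
    · exact ⟨a, fun v ↦ sub_eq_zero.1 ((sub_smul_eq ⟨z, hz⟩ a v).symm.trans (hmem v))⟩
    · obtain ⟨y, i, hi, hyi⟩ := hmax.exists_inv hmem
      generalize (⟨z, hz⟩ - algebraMap ℂ _ a : Subalgebra.center ℂ (Um q m)) = x at *
      have hyx (v : V) : ((y * x : Subalgebra.center ℂ (Um q m)) : Um q m) • v = v := by
        have h := congrArg (fun t : Subalgebra.center ℂ (Um q m) ↦ (t : Um q m) • v) hyi
        simp only [Subalgebra.coe_add, add_smul] at h
        simpa [show (i : Um q m) • v = 0 from hi v] using h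
      refine absurd (Function.bijective_iff_has_inverse.2 ⟨fun v ↦ (y : Um q m) • v,
        fun v ↦ ?_, fun v ↦ ?_⟩) ha
      · exact (mul_smul (y : Um q m) (x : Um q m) v).symm.trans (hyx v)
      · have h := hyx v
        rw [mul_comm] at h
        exact (mul_smul (x : Um q m) (y : Um q m) v).symm.trans h
  tfae_have 2 → 4 := fun h ↦ ⟨w, ⟨hw0, hEw⟩, fun v hv ↦ whittaker_eq_smul hq0 hq hm hc hEw hw h hv⟩
  tfae_have 4 → 6 := by
    rintro ⟨v₀, -, h⟩ φ
    obtain ⟨b, hb⟩ := h w hEw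
    have hb0 : b ≠ 0 := by rintro rfl; exact hw0 (by rw [hb, zero_smul])
    have hφ : uE q (fm q m) • φ w = c • φ w := by
      rw [← map_smul, hEw]; exact map_smul φ (algebraMap ℂ (Um q m) c) w
    obtain ⟨a, ha⟩ := h (φ w) hφ
    refine ⟨a * b⁻¹, fun v ↦ ?_⟩
    obtain ⟨u, rfl⟩ := hw v
    rw [map_smul, smul_comm _ u, mul_smul, ha]
    rw [hb, inv_smul_smul₀ hb0]
  tfae_have 6 → 2 := fun h z hz ↦ h (centralEnd V ⟨z, hz⟩)
  tfae_have 1 → 5 := by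
    rintro hs v ⟨hv0, -⟩ x
    exact IsSimpleModule.toSpanSingleton_surjective (Um q m) hv0 x
  tfae_have 5 → 1 := by
    intro h
    refine { eq_bot_or_eq_top := fun N ↦ or_iff_not_imp_left.2 fun hN ↦ ?_ }
    obtain ⟨v, hvN, hv⟩ := exists_whittaker_mem hq0 hq hm hc hEw hw hN
    rw [eq_top_iff]
    rintro x -
    obtain ⟨u, rfl⟩ := h v hv x
    exact N.smul_mem u hvN
  tfae_have 2 → 7 := by
    intro h
    choose! χ hχ using h
    have hχ_unique {z : Um q m} (hz : z ∈ Subalgebra.center ℂ (Um q m)) {a : ℂ}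
        (h : z • w = a • w) : χ z = a :=
      smul_left_injective ℂ hw0 ((hχ z hz w).symm.trans h)
    let ξ : Subalgebra.center ℂ (Um q m) →ₐ[ℂ] ℂ :=
      { toFun z := χ z
        map_one' := hχ_unique (one_mem _) (by rw [one_smul, one_smul])
        map_mul' x y := hχ_unique (mul_mem x.2 y.2) (by
          rw [mul_smul, hχ y y.2, hχ x x.2, mul_smul])
        map_zero' := hχ_unique (zero_mem _) (by rw [zero_smul, zero_smul])
        map_add' x y := hχ_unique (add_mem x.2 y.2) (by
          rw [add_smul, hχ y y.2, hχ x x.2, add_smul])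
        commutes' a := hχ_unique (Subalgebra.algebraMap_mem _ a) (alg a w) }
    refine ⟨ξ, ?_⟩
    set L := Submodule.span (Um q m)
      (Subtype.val '' (RingHom.ker ξ : Set (Subalgebra.center ℂ (Um q m)))) ⊔ Lc q m c
    have hle : L ≤ LinearMap.ker (LinearMap.toSpanSingleton (Um q m) V w) := by
      refine sup_le (Submodule.span_le.2 ?_) (Submodule.span_le.2 ?_)
      · rintro _ ⟨z, hz, rfl⟩
        have hz' : χ z = 0 := hz
        change (z : Um q m) • w = 0
        rw [hχ z z.2, hz', zero_smul]
      · rintro _ rfl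
        change (uE q (fm q m) - algebraMap ℂ (Um q m) c) • w = 0
        rw [sub_smul, hEw, alg, sub_self]
    have hsurj : Function.Surjective (L.liftQ _ hle) := fun x ↦ by
      obtain ⟨u, rfl⟩ := hw x
      exact ⟨L.mkQ u, rfl⟩
    have hne : L.liftQ _ hle ≠ 0 := by
      intro h0
      obtain ⟨y, hy⟩ := hsurj w
      exact hw0 (by rw [← hy, h0, LinearMap.zero_apply])
    have hs : IsSimpleModule (Um q m) (Um q m ⧸ L) := by
      refine isSimpleModule_of_central_character hq0 hq hm hc (w := L.mkQ 1) ?_ ?_ ?_ ?_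
      · intro h0
        refine hw0 ?_
        have h := congrArg (L.liftQ _ hle) h0
        rw [map_zero] at h
        exact (one_smul (Um q m) w).symm.trans h
      · have hmem : uE q (fm q m) - algebraMap ℂ (Um q m) c ∈ L :=
          Submodule.mem_sup_right (Submodule.mem_span_singleton_self _)
        rw [← map_smul, smul_eq_mul, mul_one]
        refine ((Submodule.Quotient.eq L).2 hmem).trans ?_
        rw [Algebra.algebraMap_eq_smul_one]
        rfl
      · intro x
        obtain ⟨u, rfl⟩ := L.mkQ_surjective x
        exact ⟨u, by rw [← map_smul, smul_eq_mul, mul_one]⟩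
      · intro z hz
        refine ⟨ξ ⟨z, hz⟩, fun v ↦ ?_⟩
        obtain ⟨u, rfl⟩ := L.mkQ_surjective v
        exact (central_smul_mkQ ξ ⟨z, hz⟩ u).trans (algebraMap_smul (Um q m) _ _)
    exact ⟨(LinearEquiv.ofBijective (L.liftQ _ hle)
      ⟨(LinearMap.injective_or_eq_zero _).resolve_right hne, hsurj⟩).symm⟩
  tfae_have 7 → 2 := by
    rintro ⟨ξ, ⟨e⟩⟩ z hz
    refine ⟨ξ ⟨z, hz⟩, fun v ↦ e.injective ?_⟩
    obtain ⟨u, hu⟩ := Submodule.mkQ_surjective _ (e v)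
    rw [← alg, map_smul, map_smul, ← hu]
    exact central_smul_mkQ ξ ⟨z, hz⟩ u
  tfae_finish
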